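/- Let f : (H, μ_H) → (F, μ_F) be a homomorphism of fuzzy hyper BCK-algebras. Then f is a monomorphism in the category of fuzzy hyper BCK-algebras (i.e. for every fuzzy hyper BCK-algebra (K, μ_K) and all homomorphisms of fuzzy hyper BCK-algebras h, g : (K, μ_K) → (H, μ_H), f ∘ h = f ∘ g implies h = g) if and only if f is a monomorphism in the category of hyper BCK-algebras (i.e. for every hyper BCK-algebra K and all homomorphisms of hyper BCK-algebras h, g : K → H, f ∘ h = f ∘ g implies h = g). -/

import Mathlib

/-- A hyper BCK-algebra: a carrier `H` with a hyperoperation `m` taking nonempty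
set values and a constant `zero`, satisfying (HK1), (HK2), (HK3), where `x ≪ y`
means `zero ∈ m x y` and `A ≪ B` means every `a ∈ A` has some `b ∈ B` with `a ≪ b`. -/
structure HyperBCK (H : Type*) where
  m : H → H → Set H
  zero : H
  m_nonempty : ∀ x y, (m x y).Nonempty
  hk1 : ∀ x y z : H, ∀ a ∈ ⋃ s ∈ m x z, ⋃ t ∈ m y z, m s t, ∃ b ∈ m x y, zero ∈ m a b
  hk2 : ∀ x y z : H, (⋃ s ∈ m x y, m s z) = ⋃ s ∈ m x z, m s y
  hk3 : ∀ x : H, ∀ a ∈ ⋃ t : H, m x t, zero ∈ m a x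

/-- A fuzzy hyper BCK-algebra: a hyper BCK-algebra together with `μ : H → [0,1]`
such that `inf (μ '' (x*y)) ≥ min (μ x) (μ y)` for all `x y`. -/
structure FuzzyHyperBCK (H : Type*) extends HyperBCK H where
  μ : H → ℝ
  μ_mem : ∀ x, μ x ∈ Set.Icc (0:ℝ) 1
  fuzzy : ∀ x y, min (μ x) (μ y) ≤ sInf (μ '' m x y)

/-- Homomorphism of hyper BCK-algebras: preserves the constant and
`f '' (x*y) = (f x) * (f y)` elementwise. -/
def IsHom {H F : Type*} (A : HyperBCK H) (B : HyperBCK F) (f : H → F) : Prop :=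
  f A.zero = B.zero ∧ ∀ x y, f '' A.m x y = B.m (f x) (f y)

/-- Homomorphism of fuzzy hyper BCK-algebras: a hyper BCK homomorphism with
`μ_F (f x) ≥ μ_H x` for all `x`. -/
def IsFuzzyHom {H F : Type*} (A : FuzzyHyperBCK H) (B : FuzzyHyperBCK F) (f : H → F) : Prop :=
  IsHom A.toHyperBCK B.toHyperBCK f ∧ ∀ x, A.μ x ≤ B.μ (f x)

/-- Hyper BCK-subalgebra: contains `zero` and is closed under the hyperoperation. -/
def IsSubalgebra {H : Type*} (A : HyperBCK H) (S : Set H) : Prop :=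
  A.zero ∈ S ∧ ∀ x ∈ S, ∀ y ∈ S, A.m x y ⊆ S

universe u

/-- A hyper BCK-algebra with the zero membership function. -/
def HyperBCK.toFuzzyZero {K : Type*} (C : HyperBCK K) : FuzzyHyperBCK K where
  toHyperBCK := C
  μ := fun _ => 0
  μ_mem := fun _ => ⟨le_rfl, zero_le_one⟩
  fuzzy := fun x y => by simp [(C.m_nonempty x y).image_const]

theorem IsHom.isFuzzyHom_toFuzzyZero {K H : Type*} {C : HyperBCK K} (A : FuzzyHyperBCK H)
    {h : K → H} (hh : IsHom C A.toHyperBCK h) : IsFuzzyHom C.toFuzzyZero A h :=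
  ⟨hh, fun x => (A.μ_mem (h x)).1⟩

/-- A fuzzy hyper BCK-algebra homomorphism `f : (H,μ_H) → (F,μ_F)` is a
monomorphism in the category of fuzzy hyper BCK-algebras iff it is a monomorphism in
the category of hyper BCK-algebras. -/
theorem stmt12 {H F : Type u} (A : FuzzyHyperBCK H) (B : FuzzyHyperBCK F) (f : H → F)
    (hf : IsFuzzyHom A B f) :
    (∀ (K : Type u) (C : FuzzyHyperBCK K) (h g : K → H),
        IsFuzzyHom C A h → IsFuzzyHom C A g → f ∘ h = f ∘ g → h = g) ↔
    (∀ (K : Type u) (C : HyperBCK K) (h g : K → H),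
        IsHom C A.toHyperBCK h → IsHom C A.toHyperBCK g → f ∘ h = f ∘ g → h = g) := by
  constructor
  · intro hmono K C h g hh hg
    exact hmono K C.toFuzzyZero h g (hh.isFuzzyHom_toFuzzyZero A) (hg.isFuzzyHom_toFuzzyZero A)
  · intro hmono K C h g hh hg
    exact hmono K C.toHyperBCK h g hh.1 hg.1
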